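/- Let p > 1. Let F_{m,p} denote the set of μ ∈ P_p([0,∞)) whose quantile function Q_μ is convex, non-decreasing, and satisfies lim_{u↓0} Q_μ(u) = 0, and let F̊_{m,p} denote the set of μ ∈ P_p([0,∞)) possessing a non-increasing density on [0,∞). Then F_{m,p} is the closure of F̊_{m,p} in P_p(ℝ) with respect to the p-Wasserstein distance W_p, and F_{m,p} is displacement convex. -/

import Mathlib

open MeasureTheory Set Filter

noncomputable def quantile (μ : MeasureTheory.Measure ℝ) (u : ℝ) : ℝ :=
  sInf {x : ℝ | u ≤ (μ (Set.Iic x)).toReal}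

def HasFiniteMomentP (p : ℝ) (μ : MeasureTheory.Measure ℝ) : Prop :=
  MeasureTheory.IsProbabilityMeasure μ ∧
    MeasureTheory.Integrable (fun x => |x| ^ p) μ

noncomputable def Wdist (p : ℝ) (μ ν : MeasureTheory.Measure ℝ) : ℝ :=
  (∫ u in Set.Ioo (0:ℝ) 1, |quantile μ u - quantile ν u| ^ p) ^ (1 / p)

def DisplacementConvex (F : Set (MeasureTheory.Measure ℝ)) : Prop :=
  ∀ μ ∈ F, ∀ ν ∈ F, ∀ t ∈ Set.Icc (0:ℝ) 1, ∃ σ ∈ F,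
    ∀ u ∈ Set.Ioo (0:ℝ) 1,
      quantile σ u = (1 - t) * quantile μ u + t * quantile ν u

def WClosed (p : ℝ) (F : Set (MeasureTheory.Measure ℝ)) : Prop :=
  ∀ (μs : ℕ → MeasureTheory.Measure ℝ) (μ : MeasureTheory.Measure ℝ),
    (∀ n, μs n ∈ F) → HasFiniteMomentP p μ →
    Filter.Tendsto (fun n => Wdist p (μs n) μ) Filter.atTop (nhds 0) → μ ∈ F

/-- The model `F_{m,p}`: probability measures on `[0,∞)` with finite `p`-th moment whose
quantile function is convex, non-decreasing, and tends to `0` as `u ↓ 0`. -/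
def Fmp (p : ℝ) : Set (MeasureTheory.Measure ℝ) :=
  {μ | HasFiniteMomentP p μ ∧ μ (Set.Iio (0:ℝ)) = 0 ∧
    ConvexOn ℝ (Set.Ioo (0:ℝ) 1) (quantile μ) ∧
    MonotoneOn (quantile μ) (Set.Ioo (0:ℝ) 1) ∧
    Filter.Tendsto (quantile μ) (nhdsWithin 0 (Set.Ioi 0)) (nhds 0)}

/-- The set `F̊_{m,p}` of probability measures on `[0,∞)` with finite `p`-th moment
possessing a non-increasing density on `[0,∞)`. -/
def FmpInterior (p : ℝ) : Set (MeasureTheory.Measure ℝ) :=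
  {μ | HasFiniteMomentP p μ ∧ μ (Set.Iio (0:ℝ)) = 0 ∧
    ∃ f : ℝ → ℝ, (∀ x, 0 ≤ f x) ∧ AntitoneOn f (Set.Ici (0:ℝ)) ∧
      μ = MeasureTheory.volume.withDensity (fun x => ENNReal.ofReal (f x))}

open ProbabilityTheory

/-- Galois connection between the quantile function and the distribution function. -/
lemma quantile_le_iff (μ : Measure ℝ) [IsProbabilityMeasure μ] {u : ℝ} (hu : u ∈ Ioo (0 : ℝ) 1)
    (x : ℝ) : quantile μ u ≤ x ↔ u ≤ cdf μ x := by
  have hS : {x : ℝ | u ≤ (μ (Iic x)).toReal} = {x : ℝ | u ≤ cdf μ x} := by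
    ext y; simp [cdf_eq_real, Measure.real]
  unfold quantile
  rw [hS]
  have hne : {x : ℝ | u ≤ cdf μ x}.Nonempty :=
    ((tendsto_cdf_atTop μ).eventually (eventually_ge_nhds hu.2)).exists
  have hbdd : BddBelow {x : ℝ | u ≤ cdf μ x} := by
    obtain ⟨b, hb⟩ := ((tendsto_cdf_atBot μ).eventually (eventually_lt_nhds hu.1)).exists
    refine ⟨b, fun y hy => ?_⟩
    by_contra! h
    exact absurd (lt_of_le_of_lt (le_trans hy (monotone_cdf μ h.le)) hb) (lt_irrefl _)
  refine ⟨fun h => ?_, fun h => csInf_le hbdd h⟩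
  have ht : Tendsto (cdf μ) (nhdsWithin x (Ioi x)) (nhds (cdf μ x)) :=
    ((cdf μ).right_continuous x).mono Ioi_subset_Ici_self
  refine ge_of_tendsto ht ?_
  filter_upwards [self_mem_nhdsWithin] with y hy
  obtain ⟨s, hs, hsy⟩ := exists_lt_of_csInf_lt hne (lt_of_le_of_lt h hy)
  exact le_trans hs (monotone_cdf μ hsy.le)

lemma quantile_monotoneOn (μ : Measure ℝ) [IsProbabilityMeasure μ] :
    MonotoneOn (quantile μ) (Ioo 0 1) := fun _ hu _ hv huv =>
  (quantile_le_iff μ hu _).2 (huv.trans ((quantile_le_iff μ hv _).1 le_rfl))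

/-- The uniform distribution on the open unit interval. -/
noncomputable abbrev unif : Measure ℝ := volume.restrict (Ioo (0 : ℝ) 1)

instance : IsProbabilityMeasure unif := ⟨by simp⟩

lemma aemeasurable_unif {q : ℝ → ℝ} (hq : MonotoneOn q (Ioo 0 1)) : AEMeasurable q unif :=
  aemeasurable_restrict_of_monotoneOn measurableSet_Ioo hq

lemma unif_Iic {c : ℝ} (h1 : c ≤ 1) : unif (Iic c) = ENNReal.ofReal c := by
  rw [unif, Measure.restrict_congr_set Ioo_ae_eq_Ioc, Measure.restrict_apply measurableSet_Iic]
  have : Iic c ∩ Ioc 0 1 = Ioc 0 c := by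
    ext x; simp only [mem_inter_iff, mem_Iic, mem_Ioc]
    exact ⟨fun h => ⟨h.2.1, h.1⟩, fun h => ⟨h.2, h.1, h.2.trans h1⟩⟩
  rw [this]; simp

/-- The quantile function of `μ` has law `μ` under the uniform distribution. -/
lemma map_quantile (μ : Measure ℝ) [IsProbabilityMeasure μ] :
    unif.map (quantile μ) = μ := by
  have hm := aemeasurable_unif (quantile_monotoneOn μ)
  have := Measure.isProbabilityMeasure_map hm
  refine Measure.ext_of_Iic _ _ fun x => ?_
  rw [Measure.map_apply_of_aemeasurable hm measurableSet_Iic]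
  have : quantile μ ⁻¹' Iic x =ᵐ[unif] Iic (cdf μ x) := by
    filter_upwards [ae_restrict_mem measurableSet_Ioo] with u hu
    exact propext (quantile_le_iff μ hu x)
  rw [measure_congr this, unif_Iic (cdf_le_one μ x), ofReal_cdf]

lemma hasFiniteMomentP_iff {p : ℝ} (hp : 1 < p) (μ : Measure ℝ) [IsProbabilityMeasure μ] :
    HasFiniteMomentP p μ ↔ MemLp (quantile μ) (ENNReal.ofReal p) unif := by
  have hm := aemeasurable_unif (quantile_monotoneOn μ)
  have h0 : ENNReal.ofReal p ≠ 0 := by simpa using zero_lt_one.trans hp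
  have h1 := integrable_norm_rpow_iff (μ := μ) (f := id) (p := ENNReal.ofReal p)
    aestronglyMeasurable_id h0 ENNReal.ofReal_ne_top
  rw [ENNReal.toReal_ofReal (by linarith)] at h1
  have h2 : MemLp id (ENNReal.ofReal p) μ ↔ MemLp (quantile μ) (ENNReal.ofReal p) unif := by
    conv_lhs => rw [← map_quantile μ]
    rw [memLp_map_measure_iff aestronglyMeasurable_id hm]
    rfl
  rw [← h2, ← h1]
  exact ⟨fun h => h.2, fun h => ⟨inferInstance, h⟩⟩

lemma measure_Iio_zero_iff (μ : Measure ℝ) [IsProbabilityMeasure μ] :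
    μ (Iio 0) = 0 ↔ ∀ u ∈ Ioo (0 : ℝ) 1, 0 ≤ quantile μ u := by
  constructor
  · intro h u hu
    by_contra! hlt
    have h1 := (quantile_le_iff μ hu _).1 le_rfl
    have : cdf μ (quantile μ u) = 0 := by
      rw [cdf_eq_real, Measure.real, measure_mono_null (Iic_subset_Iio.2 hlt) h]; simp
    linarith [hu.1]
  · intro h
    rw [← map_quantile μ, Measure.map_apply_of_aemeasurable
      (aemeasurable_unif (quantile_monotoneOn μ)) measurableSet_Iio]
    refine measure_mono_null (t := (Ioo 0 1)ᶜ) (fun u hu hu' => ?_) (by simp [unif])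
    exact absurd hu (not_lt.2 (h u hu'))

/-- A nondecreasing continuous function on the unit interval is the quantile function of its
law. -/
lemma quantile_map {q : ℝ → ℝ} (hq : MonotoneOn q (Ioo 0 1)) (hc : ContinuousOn q (Ioo 0 1))
    {u : ℝ} (hu : u ∈ Ioo (0 : ℝ) 1) : quantile (unif.map q) u = q u := by
  have hm := aemeasurable_unif hq
  have := Measure.isProbabilityMeasure_map hm
  have key : ∀ x, u ≤ cdf (unif.map q) x ↔ q u ≤ x := by
    intro x
    rw [cdf_eq_real, Measure.real, Measure.map_apply_of_aemeasurable hm measurableSet_Iic,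
      ← ENNReal.ofReal_le_iff_le_toReal (measure_ne_top _ _)]
    constructor
    · intro h
      by_contra! hlt
      have hev : ∀ᶠ v in nhdsWithin u (Iio u), x < q v ∧ v ∈ Ioo 0 1 := by
        have hca : ContinuousAt q u := hc.continuousAt (isOpen_Ioo.mem_nhds hu)
        exact ((hca.eventually (eventually_gt_nhds hlt)).and
          (isOpen_Ioo.eventually_mem hu)).filter_mono nhdsWithin_le_nhds
      obtain ⟨v, ⟨hxv, hv⟩, hvu⟩ := (hev.and self_mem_nhdsWithin).exists
      have hle : unif (q ⁻¹' Iic x) ≤ unif (Iic v) := by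
        refine measure_mono_ae ?_
        filter_upwards [ae_restrict_mem measurableSet_Ioo] with w hw hwx
        by_contra! hvw
        exact absurd (lt_of_lt_of_le hxv (hq hv hw (not_le.1 hvw).le)) (not_lt.2 hwx)
      rw [unif_Iic hv.2.le] at hle
      exact absurd ((ENNReal.ofReal_le_ofReal_iff hv.1.le).1 (h.trans hle)) (not_le.2 hvu)
    · intro h
      rw [← unif_Iic hu.2.le]
      refine measure_mono_ae ?_
      filter_upwards [ae_restrict_mem measurableSet_Ioo] with w hw hwu
      exact (hq hw hu hwu).trans h
  refine le_antisymm ((quantile_le_iff _ hu _).2 ((key _).2 le_rfl)) ?_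
  exact (key _).1 ((quantile_le_iff _ hu _).1 le_rfl)

/-- Convexity on the unit interval, strengthened to include the value `0` at the origin. -/
def SubconvexOnUnit (q : ℝ → ℝ) : Prop :=
  ∀ u ∈ Ioo (0 : ℝ) 1, ∀ v ∈ Ioo (0 : ℝ) 1, ∀ a b : ℝ, 0 ≤ a → 0 ≤ b → 0 < a + b → a + b ≤ 1 →
    q (a * u + b * v) ≤ a * q u + b * q v

lemma subconvex_comb_mem {u v a b : ℝ} (hu : u ∈ Ioo (0 : ℝ) 1) (hv : v ∈ Ioo (0 : ℝ) 1)
    (ha : 0 ≤ a) (hb : 0 ≤ b) (h0 : 0 < a + b) (h1 : a + b ≤ 1) :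
    a * u + b * v ∈ Ioo (0 : ℝ) 1 := by
  rcases ha.eq_or_lt with rfl | ha'
  · have hb' : 0 < b := by linarith
    constructor <;> nlinarith [hv.1, hv.2, mul_pos hb' hv.1, mul_lt_mul_of_pos_left hv.2 hb']
  · have h2 := mul_lt_mul_of_pos_left hu.2 ha'
    have h3 := mul_le_mul_of_nonneg_left hv.2.le hb
    have h4 := mul_pos ha' hu.1
    have h5 := mul_nonneg hb hv.1.le
    constructor <;> linarith

lemma SubconvexOnUnit.convexOn {q : ℝ → ℝ} (h : SubconvexOnUnit q) :
    ConvexOn ℝ (Ioo 0 1) q :=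
  ⟨convex_Ioo 0 1, fun u hu v hv a b ha hb hab => by
    simpa using h u hu v hv a b ha hb (by linarith) hab.le⟩

lemma SubconvexOnUnit.tendsto_zero {q : ℝ → ℝ} (h : SubconvexOnUnit q)
    (h0 : ∀ u ∈ Ioo (0 : ℝ) 1, 0 ≤ q u) : Tendsto q (nhdsWithin 0 (Ioi 0)) (nhds 0) := by
  have hev : ∀ᶠ u : ℝ in nhdsWithin 0 (Ioi 0), u ∈ Ioo (0 : ℝ) (1 / 2) :=
    Ioo_mem_nhdsGT (by norm_num)
  have hlim : Tendsto (fun u : ℝ => 2 * u * q (1 / 2)) (nhdsWithin 0 (Ioi 0)) (nhds 0) := by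
    have : Continuous fun u : ℝ => 2 * u * q (1 / 2) := by fun_prop
    simpa using (this.tendsto 0).mono_left (nhdsWithin_le_nhds (s := Ioi 0))
  refine tendsto_of_tendsto_of_tendsto_of_le_of_le' tendsto_const_nhds hlim ?_ ?_
  · filter_upwards [hev] with u hu
    exact h0 u ⟨hu.1, by linarith [hu.2]⟩
  · filter_upwards [hev] with u hu
    have := h (1 / 2) (by norm_num) (1 / 2) (by norm_num) (2 * u) 0 (by linarith [hu.1]) le_rfl
      (by linarith [hu.1]) (by linarith [hu.2])
    simpa [mul_comm, mul_left_comm] using this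

lemma ConvexOn.subconvexOnUnit {q : ℝ → ℝ} (h : ConvexOn ℝ (Ioo 0 1) q)
    (h0 : Tendsto q (nhdsWithin 0 (Ioi 0)) (nhds 0)) : SubconvexOnUnit q := by
  have key : ∀ v ∈ Ioo (0 : ℝ) 1, ∀ s : ℝ, 0 < s → s ≤ 1 → q (s * v) ≤ s * q v := by
    intro v hv s hs hs1
    rcases hs1.eq_or_lt with rfl | hs1
    · simp
    have hw : s * v ∈ Ioo (0 : ℝ) 1 := by
      simpa using subconvex_comb_mem hv hv hs.le le_rfl (by linarith) (by linarith)
    have hcont : ContinuousAt q (s * v) :=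
      (h.continuousOn isOpen_Ioo).continuousAt (isOpen_Ioo.mem_nhds hw)
    have hl : Tendsto (fun e : ℝ => q (s * v + (1 - s) * e)) (nhdsWithin 0 (Ioi 0))
        (nhds (q (s * v))) := by
      refine hcont.tendsto.comp ?_
      have : Continuous fun e : ℝ => s * v + (1 - s) * e := by fun_prop
      simpa using (this.tendsto 0).mono_left (nhdsWithin_le_nhds (s := Ioi 0))
    have hr : Tendsto (fun e : ℝ => s * q v + (1 - s) * q e) (nhdsWithin 0 (Ioi 0))
        (nhds (s * q v)) := by
      simpa using (h0.const_mul (1 - s)).const_add (s * q v)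
    refine le_of_tendsto_of_tendsto hl hr ?_
    filter_upwards [Ioo_mem_nhdsGT (zero_lt_one (α := ℝ))] with e he
    simpa using h.2 hv he hs.le (by linarith : 0 ≤ 1 - s) (by ring)
  intro u hu v hv a b ha hb hab hab1
  have hc := h.2 hu hv (div_nonneg ha hab.le) (div_nonneg hb hab.le)
    (by rw [← add_div, div_self hab.ne'])
  have hmem := h.1 hu hv (div_nonneg ha hab.le) (div_nonneg hb hab.le)
    (by rw [← add_div, div_self hab.ne'])
  have hk := key _ hmem _ hab hab1
  simp only [smul_eq_mul] at hc hk
  have e1 : ∀ x y : ℝ, (a + b) * (a / (a + b) * x + b / (a + b) * y) = a * x + b * y := by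
    intro x y; field_simp
  rw [e1] at hk
  have := mul_le_mul_of_nonneg_left hc hab.le
  rw [e1] at this
  exact hk.trans this

lemma mem_Fmp_iff {p : ℝ} {μ : Measure ℝ} (hμ : HasFiniteMomentP p μ) :
    μ ∈ Fmp p ↔ (∀ u ∈ Ioo (0 : ℝ) 1, 0 ≤ quantile μ u) ∧ SubconvexOnUnit (quantile μ) := by
  have := hμ.1
  rw [← measure_Iio_zero_iff]
  constructor
  · rintro ⟨_, h1, h2, -, h3⟩
    exact ⟨h1, h2.subconvexOnUnit h3⟩
  · rintro ⟨h1, h2⟩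
    exact ⟨hμ, h1, h2.convexOn, quantile_monotoneOn μ,
      h2.tendsto_zero ((measure_Iio_zero_iff μ).1 h1)⟩

/-- The distribution function of a measure with nonincreasing density is concave. -/
lemma concaveOn_cdf_withDensity {f : ℝ → ℝ} (hf0 : ∀ x, 0 ≤ f x) (hf : AntitoneOn f (Ici 0))
    {μ : Measure ℝ} [IsProbabilityMeasure μ]
    (hμ : μ = volume.withDensity fun x => ENNReal.ofReal (f x)) :
    ConcaveOn ℝ (Ici 0) (cdf μ) := by
  have hIoc : ∀ x y, μ (Ioc x y) = ENNReal.ofReal (cdf μ y - cdf μ x) := fun x y => by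
    conv_lhs => rw [← measure_cdf μ]
    exact (cdf μ).measure_Ioc x y
  have hint : ∀ x y, μ (Ioc x y) = ∫⁻ t in Ioc x y, ENNReal.ofReal (f t) := fun x y => by
    rw [hμ, withDensity_apply _ measurableSet_Ioc]
  have hlow : ∀ x y, 0 ≤ x → x < y → f y * (y - x) ≤ cdf μ y - cdf μ x := by
    intro x y hx hxy
    rw [← ENNReal.ofReal_le_ofReal_iff (sub_nonneg.2 (monotone_cdf μ hxy.le)), ← hIoc, hint,
      ENNReal.ofReal_mul (hf0 y), ← Real.volume_Ioc, ← setLIntegral_const]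
    exact setLIntegral_mono' measurableSet_Ioc fun t ht => ENNReal.ofReal_le_ofReal
      (hf (hx.trans ht.1.le) (hx.trans hxy.le) ht.2)
  have hupp : ∀ x y, 0 ≤ x → x < y → cdf μ y - cdf μ x ≤ f x * (y - x) := by
    intro x y hx hxy
    rw [← ENNReal.ofReal_le_ofReal_iff (mul_nonneg (hf0 x) (sub_nonneg.2 hxy.le)), ← hIoc, hint,
      ENNReal.ofReal_mul (hf0 x), ← Real.volume_Ioc, ← setLIntegral_const]
    exact setLIntegral_mono' measurableSet_Ioc fun t ht => ENNReal.ofReal_le_ofReal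
      (hf hx (hx.trans ht.1.le) ht.1.le)
  refine concaveOn_of_slope_anti_adjacent (convex_Ici 0) fun {x y z} hx _ hxy hyz => ?_
  have hx : (0 : ℝ) ≤ x := hx
  exact ((div_le_iff₀ (by linarith)).2 (hupp y z (by linarith) hyz)).trans
    ((le_div_iff₀ (by linarith)).2 (hlow x y hx hxy))

lemma FmpInterior_subset_Fmp (p : ℝ) : FmpInterior p ⊆ Fmp p := by
  rintro μ ⟨hm, h0, f, hf0, hf, hμ⟩
  have := hm.1
  have hc := concaveOn_cdf_withDensity hf0 hf hμ
  have hF0 : cdf μ 0 = 0 := by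
    have hac : μ ≪ volume := hμ ▸ withDensity_absolutelyContinuous _ _
    have h00 : μ {0} = 0 := hac (by simp)
    have : μ (Iic 0) = 0 := by
      rw [← Iio_union_right]; exact measure_union_null h0 h00
    simp [cdf_eq_real, Measure.real, this]
  have hq0 := (measure_Iio_zero_iff μ).1 h0
  refine (mem_Fmp_iff hm).2 ⟨hq0, fun u hu v hv a b ha hb hab hab1 => ?_⟩
  rw [quantile_le_iff μ (subconvex_comb_mem hu hv ha hb hab hab1)]
  have hQu := (quantile_le_iff μ hu _).1 le_rfl
  have hQv := (quantile_le_iff μ hv _).1 le_rfl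
  have hc1 := hc.2 (hq0 u hu) (hq0 v hv) (div_nonneg ha hab.le) (div_nonneg hb hab.le)
    (by rw [← add_div, div_self hab.ne'])
  have hmem := hc.1 (hq0 u hu) (hq0 v hv) (div_nonneg ha hab.le) (div_nonneg hb hab.le)
    (by rw [← add_div, div_self hab.ne'])
  have hc2 := hc.2 hmem self_mem_Ici hab.le (sub_nonneg.2 hab1) (by ring)
  simp only [smul_eq_mul, hF0, mul_zero, add_zero] at hc1 hc2
  have e1 : ∀ x y : ℝ, (a + b) * (a / (a + b) * x + b / (a + b) * y) = a * x + b * y := by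
    intro x y; field_simp
  rw [e1] at hc2
  have h1 := mul_le_mul_of_nonneg_left hc1 hab.le
  rw [e1] at h1
  refine le_trans ?_ (h1.trans hc2)
  gcongr

lemma exists_mem_Fmp_quantile_eq {p : ℝ} (hp : 1 < p) {q : ℝ → ℝ} (hq : ConvexOn ℝ (Ioo 0 1) q)
    (hmono : MonotoneOn q (Ioo 0 1)) (h0 : Tendsto q (nhdsWithin 0 (Ioi 0)) (nhds 0))
    (hL : MemLp q (ENNReal.ofReal p) unif) :
    ∃ σ ∈ Fmp p, ∀ u ∈ Ioo (0 : ℝ) 1, quantile σ u = q u := by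
  have hc := hq.continuousOn isOpen_Ioo
  have := Measure.isProbabilityMeasure_map (aemeasurable_unif hmono)
  have heq : EqOn (quantile (unif.map q)) q (Ioo 0 1) := fun u hu => quantile_map hmono hc hu
  have hnn : ∀ u ∈ Ioo (0 : ℝ) 1, 0 ≤ quantile (unif.map q) u := fun u hu => by
    rw [heq hu]
    refine le_of_tendsto h0 ?_
    filter_upwards [Ioo_mem_nhdsGT hu.1] with e he
    exact hmono ⟨he.1, he.2.trans hu.2⟩ hu he.2.le
  refine ⟨unif.map q, ⟨(hasFiniteMomentP_iff hp _).2 ?_, (measure_Iio_zero_iff _).2 hnn,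
    hq.congr heq.symm, quantile_monotoneOn _, h0.congr' ?_⟩, heq⟩
  · refine (memLp_congr_ae ?_).2 hL
    filter_upwards [ae_restrict_mem measurableSet_Ioo] with u hu using heq hu
  · filter_upwards [Ioo_mem_nhdsGT (zero_lt_one (α := ℝ))] with u hu using (heq hu).symm

lemma Fmp_displacementConvex {p : ℝ} (hp : 1 < p) : DisplacementConvex (Fmp p) := by
  rintro μ ⟨hμ, -, hμc, hμm, hμ0⟩ ν ⟨hν, -, hνc, hνm, hν0⟩ t ⟨ht0, ht1⟩
  have := hμ.1
  have := hν.1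
  have ht1' : 0 ≤ 1 - t := sub_nonneg.2 ht1
  refine exists_mem_Fmp_quantile_eq hp (q := fun u => (1 - t) * quantile μ u + t * quantile ν u)
    ((hμc.smul ht1').add (hνc.smul ht0)) (fun u hu v hv huv => ?_) ?_ ?_
  · have h1 := hμm hu hv huv
    have h2 := hνm hu hv huv
    dsimp only
    gcongr
  · simpa using (hμ0.const_mul (1 - t)).add (hν0.const_mul t)
  · exact (((hasFiniteMomentP_iff hp μ).1 hμ).const_mul (1 - t)).add
      (((hasFiniteMomentP_iff hp ν).1 hν).const_mul t)

/-- Convergence in Wasserstein distance implies convergence of the quantile functions almost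
everywhere along a subsequence. -/
lemma exists_subseq_tendsto_quantile {p : ℝ} (hp : 1 < p) {μs : ℕ → Measure ℝ} {μ : Measure ℝ}
    (hμs : ∀ n, HasFiniteMomentP p (μs n)) (hμ : HasFiniteMomentP p μ)
    (h : Tendsto (fun n => Wdist p (μs n) μ) atTop (nhds 0)) :
    ∃ ns : ℕ → ℕ, ∀ᵐ u ∂unif,
      Tendsto (fun i => quantile (μs (ns i)) u) atTop (nhds (quantile μ u)) := by
  have := hμ.1
  have := fun n => (hμs n).1
  have hp0 : 0 < p := zero_lt_one.trans hp
  set g : ℕ → ℝ → ℝ := fun n u => |quantile (μs n) u - quantile μ u| ^ p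
  have hg0 : ∀ n u, 0 ≤ g n u := fun n u => by positivity
  have hgi : ∀ n, Integrable (g n) unif := fun n => by
    have hL := ((hasFiniteMomentP_iff hp (μs n)).1 (hμs n)).sub ((hasFiniteMomentP_iff hp μ).1 hμ)
    have := hL.integrable_norm_rpow (by simpa using hp0) ENNReal.ofReal_ne_top
    rwa [ENNReal.toReal_ofReal hp0.le] at this
  have hlim : Tendsto (fun n => ∫ u, g n u ∂unif) atTop (nhds 0) := by
    have h1 := h.rpow_const (p := p) (Or.inr hp0.le)
    rw [Real.zero_rpow hp0.ne'] at h1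
    refine h1.congr fun n => ?_
    rw [Wdist, ← Real.rpow_mul (integral_nonneg (hg0 n)), one_div_mul_cancel hp0.ne',
      Real.rpow_one]
  have hmeas : TendstoInMeasure unif g atTop (fun _ => 0) := by
    refine tendstoInMeasure_of_tendsto_eLpNorm (p := 1) one_ne_zero
      (fun n => (hgi n).aestronglyMeasurable) aestronglyMeasurable_const ?_
    have := ENNReal.tendsto_ofReal hlim
    rw [ENNReal.ofReal_zero] at this
    refine this.congr fun n => ?_
    rw [eLpNorm_one_eq_lintegral_enorm, ofReal_integral_eq_lintegral_ofReal (hgi n)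
      (Eventually.of_forall (hg0 n))]
    refine lintegral_congr fun u => ?_
    simp [Real.enorm_of_nonneg (hg0 n u)]
  obtain ⟨ns, -, hns⟩ := hmeas.exists_seq_tendsto_ae
  refine ⟨ns, ?_⟩
  filter_upwards [hns] with u hu
  have h1 := hu.rpow_const (p := p⁻¹) (Or.inr (inv_nonneg.2 hp0.le))
  rw [Real.zero_rpow (inv_ne_zero hp0.ne')] at h1
  rw [tendsto_iff_norm_sub_tendsto_zero]
  refine h1.congr fun n => ?_
  exact Real.rpow_rpow_inv (abs_nonneg _) hp0.ne'

lemma exists_mem_Ioo_of_ae_unif {P : ℝ → Prop} (hP : ∀ᵐ u ∂unif, P u) {a b : ℝ} (hab : a < b)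
    (ha : 0 ≤ a) (hb : b ≤ 1) : ∃ u ∈ Ioo a b, P u := by
  by_contra! hcon
  have h1 : unif (Ioo a b) = 0 := measure_mono_null (fun u hu => hcon u hu) hP
  rw [Measure.restrict_apply measurableSet_Ioo,
    inter_eq_left.2 (Ioo_subset_Ioo ha hb), Real.volume_Ioo] at h1
  exact absurd (ENNReal.ofReal_eq_zero.1 h1) (by linarith)

/-- `Fmp p` is closed under Wasserstein limits. -/
lemma Fmp_wClosed {p : ℝ} (hp : 1 < p) : WClosed p (Fmp p) := by
  intro μs μ hμs hμ h
  have := hμ.1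
  have := fun n => (hμs n).1.1
  obtain ⟨ns, hns⟩ := exists_subseq_tendsto_quantile hp (fun n => (hμs n).1) hμ h
  have hmono := quantile_monotoneOn μ
  have hF := fun n => (mem_Fmp_iff (hμs n).1).1 (hμs n)
  refine (mem_Fmp_iff hμ).2 ⟨fun u hu => ?_, fun u hu v hv a b ha hb hab hab1 => ?_⟩
  · obtain ⟨w, hw, hwt⟩ := exists_mem_Ioo_of_ae_unif hns hu.1 le_rfl hu.2.le
    have hw' : w ∈ Ioo (0 : ℝ) 1 := ⟨hw.1, hw.2.trans hu.2⟩
    exact (ge_of_tendsto' hwt fun n => (hF (ns n)).1 w hw').trans (hmono hw' hu hw.2.le)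
  · have hw := subconvex_comb_mem hu hv ha hb hab hab1
    set w := a * u + b * v with hwdef
    rw [quantile_le_iff μ hw]
    refine le_of_forall_lt_imp_le_of_dense fun c hc => ?_
    obtain ⟨w', ⟨hw'l, hw'r⟩, hw't⟩ := exists_mem_Ioo_of_ae_unif hns
      (max_lt hc hw.1) (le_max_right c 0) hw.2.le
    have hw' : w' ∈ Ioo (0 : ℝ) 1 := ⟨(le_max_right c 0).trans_lt hw'l, hw'r.trans hw.2⟩
    obtain ⟨u', ⟨hu'l, hu'r⟩, hu't⟩ := exists_mem_Ioo_of_ae_unif hns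
      (max_lt (sub_lt_self u (sub_pos.2 hw'r)) hu.1) (le_max_right _ 0) hu.2.le
    obtain ⟨v', ⟨hv'l, hv'r⟩, hv't⟩ := exists_mem_Ioo_of_ae_unif hns
      (max_lt (sub_lt_self v (sub_pos.2 hw'r)) hv.1) (le_max_right _ 0) hv.2.le
    rw [max_lt_iff] at hu'l hv'l
    have hu' : u' ∈ Ioo (0 : ℝ) 1 := ⟨hu'l.2, hu'r.trans hu.2⟩
    have hv' : v' ∈ Ioo (0 : ℝ) 1 := ⟨hv'l.2, hv'r.trans hv.2⟩
    have hle : w' ≤ a * u' + b * v' := by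
      have h1 := mul_le_mul_of_nonneg_left hu'l.1.le ha
      have h2 := mul_le_mul_of_nonneg_left hv'l.1.le hb
      nlinarith [mul_nonneg (sub_nonneg.2 hab1) (sub_pos.2 hw'r).le]
    have hlim : quantile μ w' ≤ a * quantile μ u' + b * quantile μ v' :=
      le_of_tendsto_of_tendsto' hw't ((hu't.const_mul a).add (hv't.const_mul b)) fun n =>
        (quantile_monotoneOn _ hw' (subconvex_comb_mem hu' hv' ha hb hab hab1) hle).trans
          ((hF (ns n)).2 u' hu' v' hv' a b ha hb hab hab1)
    refine ((le_max_left c 0).trans hw'l.le).trans ((quantile_le_iff μ hw' _).1 (hlim.trans ?_))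
    have h1 := hmono hu' hu hu'r.le
    have h2 := hmono hv' hv hv'r.le
    gcongr

/-- A uniform lower bound on the slopes of the quantile function bounds the slopes of the
distribution function from above. -/
lemma cdf_sub_le {μ : Measure ℝ} [IsProbabilityMeasure μ] {c : ℝ} (hc : 0 < c)
    (hQ : ∀ u ∈ Ioo (0 : ℝ) 1, ∀ v ∈ Ioo (0 : ℝ) 1, u < v →
      c * (v - u) ≤ quantile μ v - quantile μ u) {x y : ℝ} (hxy : x ≤ y) :
    cdf μ y - cdf μ x ≤ c⁻¹ * (y - x) := by
  by_contra! hlt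
  have h0 : 0 ≤ c⁻¹ * (y - x) := mul_nonneg (inv_nonneg.2 hc.le) (sub_nonneg.2 hxy)
  obtain ⟨u, hu1, hu2⟩ := exists_between (show cdf μ x < cdf μ y - c⁻¹ * (y - x) by linarith)
  obtain ⟨v, hv1, hv2⟩ := exists_between (show u + c⁻¹ * (y - x) < cdf μ y by linarith)
  have hu : u ∈ Ioo (0 : ℝ) 1 :=
    ⟨(cdf_nonneg μ x).trans_lt hu1, by linarith [cdf_le_one μ y]⟩
  have hv : v ∈ Ioo (0 : ℝ) 1 := ⟨by linarith [hu.1], hv2.trans_le (cdf_le_one μ y)⟩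
  have h1 : quantile μ v ≤ y := (quantile_le_iff μ hv y).2 hv2.le
  have h2 : x < quantile μ u := not_le.1 fun h => absurd ((quantile_le_iff μ hu x).1 h)
    (not_le.2 hu1)
  have h3 := hQ u hu v hv (by linarith)
  have h4 : c * (c⁻¹ * (y - x)) < c * (v - u) := mul_lt_mul_of_pos_left (by linarith) hc
  rw [mul_inv_cancel_left₀ hc.ne'] at h4
  linarith

lemma cdf_pos {μ : Measure ℝ} [IsProbabilityMeasure μ]
    (h0 : Tendsto (quantile μ) (nhdsWithin 0 (Ioi 0)) (nhds 0)) {x : ℝ} (hx : 0 < x) :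
    0 < cdf μ x := by
  obtain ⟨u, hux, hu⟩ := ((h0.eventually (eventually_le_nhds hx)).and
    (Ioo_mem_nhdsGT (zero_lt_one (α := ℝ)))).exists
  exact hu.1.trans_le ((quantile_le_iff μ hu x).1 hux)

/-- A convex quantile function vanishing at the origin has a concave inverse. -/
lemma concaveOn_cdf {p : ℝ} {μ : Measure ℝ} (hμ : μ ∈ Fmp p) :
    ConcaveOn ℝ (Ioi 0) (cdf μ) := by
  obtain ⟨hm, -, hconv, -, h0⟩ := hμ
  have := hm.1
  refine ⟨convex_Ioi 0, fun x hx y hy a b ha hb hab => ?_⟩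
  have hFx := cdf_pos h0 hx
  have hFy := cdf_pos h0 hy
  simp only [smul_eq_mul]
  have key : ∀ s ∈ Ioo (0 : ℝ) 1,
      a * (s * cdf μ x) + b * (s * cdf μ y) ≤ cdf μ (a * x + b * y) := by
    intro s hs
    have hlt : ∀ z, 0 < cdf μ z → s * cdf μ z ∈ Ioo (0 : ℝ) 1 ∧ s * cdf μ z ≤ cdf μ z :=
      fun z hz => ⟨⟨mul_pos hs.1 hz, by nlinarith [cdf_le_one μ z, hs.2]⟩, by nlinarith [hs.2]⟩
    obtain ⟨hu, hux⟩ := hlt x hFx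
    obtain ⟨hv, hvy⟩ := hlt y hFy
    rw [← quantile_le_iff μ (subconvex_comb_mem hu hv ha hb (by linarith) hab.le)]
    refine (hconv.2 hu hv ha hb hab).trans ?_
    have h1 := (quantile_le_iff μ hu x).2 hux
    have h2 := (quantile_le_iff μ hv y).2 hvy
    simp only [smul_eq_mul]
    gcongr
  have hl : Tendsto (fun s : ℝ => a * (s * cdf μ x) + b * (s * cdf μ y)) (nhdsWithin 1 (Iio 1))
      (nhds (a * cdf μ x + b * cdf μ y)) := by
    have : Continuous fun s : ℝ => a * (s * cdf μ x) + b * (s * cdf μ y) := by fun_prop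
    simpa using (this.tendsto 1).mono_left (nhdsWithin_le_nhds (s := Iio 1))
  refine le_of_tendsto hl ?_
  filter_upwards [Ioo_mem_nhdsLT (zero_lt_one (α := ℝ))] with s hs using key s hs

/-- A measure in `Fmp p` whose quantile function has slopes bounded away from zero has a
nonincreasing density. -/
lemma mem_FmpInterior_of_slope_ge {p : ℝ} {μ : Measure ℝ} (hμ : μ ∈ Fmp p) {c : ℝ} (hc : 0 < c)
    (hQ : ∀ u ∈ Ioo (0 : ℝ) 1, ∀ v ∈ Ioo (0 : ℝ) 1, u < v →
      c * (v - u) ≤ quantile μ v - quantile μ u) : μ ∈ FmpInterior p := by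
  have hconc := concaveOn_cdf hμ
  have := hμ.1.1
  have hq0 := (measure_Iio_zero_iff μ).1 hμ.2.1
  have hlip : LipschitzWith ⟨c⁻¹, inv_nonneg.2 hc.le⟩ (cdf μ) := by
    refine LipschitzWith.of_le_add_mul _ fun x y => ?_
    change cdf μ x ≤ cdf μ y + c⁻¹ * dist x y
    rcases le_total x y with hxy | hxy
    · have := monotone_cdf μ hxy
      have : 0 ≤ c⁻¹ * dist x y := by positivity
      linarith
    · have := cdf_sub_le hc hQ hxy
      rw [Real.dist_eq, abs_of_nonneg (sub_nonneg.2 hxy)]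
      linarith
  have hF0 : cdf μ 0 = 0 := by
    refine le_antisymm (not_lt.1 fun h => ?_) (cdf_nonneg μ 0)
    obtain ⟨u, hu0, hu1⟩ := exists_between (lt_min h zero_lt_one)
    have hu : u ∈ Ioo (0 : ℝ) 1 := ⟨hu0, hu1.trans_le (min_le_right _ _)⟩
    have hu2 : u / 2 ∈ Ioo (0 : ℝ) 1 := ⟨by linarith, by linarith [hu.2]⟩
    have h1 := (quantile_le_iff μ hu 0).2 (hu1.le.trans (min_le_left _ _))
    have h2 := hQ _ hu2 _ hu (by linarith)
    have h3 := hq0 _ hu2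
    nlinarith
  set g : ℝ → ℝ := fun x => -derivWithin (-⇑(cdf μ)) (Ioi x) x with hg
  have hderiv : ∀ x, 0 < x → HasDerivWithinAt (cdf μ) (g x) (Ioi x) x := fun x hx => by
    have := (hconc.neg.hasDerivWithinAt_rightDeriv_of_mem_interior
      (by rwa [interior_Ioi])).neg (x := x)
    rwa [neg_neg] at this
  have hanti : AntitoneOn g (Ioi 0) := fun x hx y hy hxy => by
    have := hconc.neg.monotoneOn_rightDeriv
    rw [interior_Ioi] at this
    exact neg_le_neg (this hx hy hxy)
  have hbound : ∀ x, 0 < x → 0 ≤ g x ∧ g x ≤ c⁻¹ := fun x hx => by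
    have ht := (hasDerivWithinAt_iff_tendsto_slope' self_notMem_Ioi).1 (hderiv x hx)
    constructor
    · refine ge_of_tendsto ht ?_
      filter_upwards [self_mem_nhdsWithin] with y hy
      rw [slope_def_field]
      exact div_nonneg (sub_nonneg.2 (monotone_cdf μ (le_of_lt hy))) (sub_nonneg.2 (le_of_lt hy))
    · refine le_of_tendsto ht ?_
      filter_upwards [self_mem_nhdsWithin] with y hy
      rw [slope_def_field, div_le_iff₀ (sub_pos.2 hy)]
      exact cdf_sub_le hc hQ (le_of_lt hy)
  set f : ℝ → ℝ := fun x => if 0 < x then g x else if x = 0 then c⁻¹ else 0 with hf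
  have hfpos : ∀ x, 0 < x → f x = g x := fun x hx => if_pos hx
  have hfzero : f 0 = c⁻¹ := by simp [hf]
  have hfneg : ∀ x, x < 0 → f x = 0 := fun x hx => by simp [hf, hx.le, hx.ne]
  have hf0 : ∀ x, 0 ≤ f x := fun x => by
    rcases lt_trichotomy x 0 with h | rfl | h
    · rw [hfneg x h]
    · rw [hfzero]; positivity
    · rw [hfpos x h]; exact (hbound x h).1
  have hfanti : AntitoneOn f (Ici 0) := by
    intro x hx y hy hxy
    rcases (mem_Ici.1 hx).eq_or_lt with rfl | hx
    · rcases hxy.eq_or_lt with rfl | hxy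
      · rfl
      · rw [hfzero, hfpos y hxy]; exact (hbound y hxy).2
    · have hy := hx.trans_le hxy
      rw [hfpos x hx, hfpos y hy]
      exact hanti hx hy hxy
  refine ⟨hμ.1, hμ.2.1, f, hf0, hfanti, ?_⟩
  refine Measure.ext_of_Iic _ _ fun x => ?_
  rw [withDensity_apply _ measurableSet_Iic, ← ofReal_cdf]
  have hzero : ∫⁻ t in Iic 0, ENNReal.ofReal (f t) = 0 := by
    rw [setLIntegral_congr Iio_ae_eq_Iic.symm]
    refine (setLIntegral_congr_fun measurableSet_Iio fun t ht => ?_).trans lintegral_zero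
    simp [hfneg t ht]
  rcases le_total x 0 with hx | hx
  · rw [le_antisymm (hF0 ▸ monotone_cdf μ hx) (cdf_nonneg μ x), ENNReal.ofReal_zero]
    exact (le_antisymm ((lintegral_mono_set (Iic_subset_Iic.2 hx)).trans hzero.le) zero_le).symm
  · rw [← Iic_union_Ioc_eq_Iic hx, lintegral_union measurableSet_Ioc
      (Iic_disjoint_Ioc le_rfl), hzero, zero_add]
    have hint : IntervalIntegrable f volume 0 x :=
      (hfanti.mono (by rw [uIcc_of_le hx]; exact Icc_subset_Ici_self)).intervalIntegrable
    have hFTC := intervalIntegral.integral_eq_sub_of_hasDeriv_right_of_le hx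
      hlip.continuous.continuousOn (fun t ht => hfpos t ht.1 ▸ hderiv t ht.1) hint
    rw [hF0, sub_zero] at hFTC
    rw [← hFTC, intervalIntegral.integral_of_le hx]
    exact ofReal_integral_eq_lintegral_ofReal
      ((intervalIntegrable_iff_integrableOn_Ioc_of_le hx).1 hint) (Eventually.of_forall hf0)

lemma exists_seq_FmpInterior {p : ℝ} (hp : 1 < p) {μ : Measure ℝ} (hμ : μ ∈ Fmp p) :
    ∃ μs : ℕ → Measure ℝ, (∀ n, μs n ∈ FmpInterior p) ∧
      Tendsto (fun n => Wdist p (μs n) μ) atTop (nhds 0) := by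
  obtain ⟨hm, -, hconv, hmono, h0⟩ := hμ
  have := hm.1
  have hp0 : 0 < p := zero_lt_one.trans hp
  set c : ℕ → ℝ := fun n => 1 / ((n : ℝ) + 1) with hcdef
  have hc : ∀ n, 0 < c n := fun n => Nat.one_div_pos_of_nat
  have hex : ∀ n, ∃ σ ∈ Fmp p, ∀ u ∈ Ioo (0 : ℝ) 1, quantile σ u = quantile μ u + c n * u := by
    intro n
    refine exists_mem_Fmp_quantile_eq hp
      (hconv.add ((convexOn_id (convex_Ioo 0 1)).smul (hc n).le)) (fun u hu v hv huv => ?_) ?_ ?_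
    · have h1 := hmono hu hv huv
      have h2 := (hc n).le
      gcongr
    · have : Continuous fun u : ℝ => c n * u := by fun_prop
      simpa using h0.add ((this.tendsto 0).mono_left (nhdsWithin_le_nhds (s := Ioi 0)))
    · refine ((hasFiniteMomentP_iff hp μ).1 hm).add (MemLp.of_bound (by fun_prop) (c n) ?_)
      filter_upwards [ae_restrict_mem measurableSet_Ioo] with u hu
      rw [Real.norm_of_nonneg (mul_nonneg (hc n).le hu.1.le)]
      exact mul_le_of_le_one_right (hc n).le hu.2.le
  choose μs hμs hq using hex
  refine ⟨μs, fun n => mem_FmpInterior_of_slope_ge (hμs n) (hc n) fun u hu v hv huv => ?_, ?_⟩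
  · rw [hq n u hu, hq n v hv]
    linarith [hmono hu hv huv.le]
  · have hW : ∀ n, Wdist p (μs n) μ = c n * (∫ u in Ioo (0 : ℝ) 1, |u| ^ p) ^ (1 / p) := by
      intro n
      have : ∫ u in Ioo (0 : ℝ) 1, |quantile (μs n) u - quantile μ u| ^ p =
          (c n) ^ p * ∫ u in Ioo (0 : ℝ) 1, |u| ^ p := by
        rw [← integral_const_mul]
        refine setIntegral_congr_fun measurableSet_Ioo fun u hu => ?_
        simp only [hq n u hu, add_sub_cancel_left, abs_mul, abs_of_pos (hc n)]
        exact Real.mul_rpow (hc n).le (abs_nonneg u)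
      rw [Wdist, this, Real.mul_rpow (Real.rpow_nonneg (hc n).le p)
        (integral_nonneg fun u => by positivity), one_div, Real.rpow_rpow_inv (hc n).le hp0.ne']
    simp only [hW]
    simpa [hcdef] using tendsto_one_div_add_atTop_nhds_zero_nat.mul_const
      ((∫ u in Ioo (0 : ℝ) 1, |u| ^ p) ^ (1 / p))

/-- Proposition 3.2. For `p > 1`, the set `F_{m,p}` is the closure of
`F̊_{m,p}` with respect to the `p`-Wasserstein distance, and `F_{m,p}` is displacement
convex. -/
theorem Fmp_closure_and_displacementConvex (p : ℝ) (hp : 1 < p) :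
    (Fmp p = {μ | HasFiniteMomentP p μ ∧
        ∃ μs : ℕ → MeasureTheory.Measure ℝ, (∀ n, μs n ∈ FmpInterior p) ∧
          Filter.Tendsto (fun n => Wdist p (μs n) μ) Filter.atTop (nhds 0)}) ∧
      DisplacementConvex (Fmp p) := by
  refine ⟨Subset.antisymm (fun μ hμ => ⟨hμ.1, exists_seq_FmpInterior hp hμ⟩) ?_,
    Fmp_displacementConvex hp⟩
  rintro μ ⟨hm, μs, hμs, h⟩
  exact Fmp_wClosed hp μs μ (fun n => FmpInterior_subset_Fmp p (hμs n)) hm h
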